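/- Any Boolean function f : (ℤ_q)^n → {−1,1} of degree at most d, with q ≥ 3, has at most d·q^{d+1}/(4(q−1)) relevant variables. -/

import Mathlib

open Finset BigOperators
open scoped Classical

/-- The character `χ_u(x) = ω^{⟨u,x⟩}` on `(ℤ_q)^n`, with `ω = e^{2πi/q}`. -/
noncomputable def chi (q n : ℕ) (u x : Fin n → ZMod q) : ℂ :=
  Complex.exp (2 * Real.pi * Complex.I * (((∑ i, u i * x i).val : ℕ) : ℂ) / q)

/-- Fourier coefficient `f̂(u) = q^{-n} Σ_x f(x) conj(χ_u(x))`. -/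
noncomputable def fhat (q n : ℕ) [NeZero q] (f : (Fin n → ZMod q) → ℂ)
    (u : Fin n → ZMod q) : ℂ :=
  (1 / (q : ℂ) ^ n) * ∑ x, f x * (starRingEnd ℂ) (chi q n u x)

/-- Adjacency operator of the Hamming graph `H(n,q)`. -/
noncomputable def adjOp (q n : ℕ) [NeZero q] (f : (Fin n → ZMod q) → ℂ)
    (x : Fin n → ZMod q) : ℂ :=
  ∑ y ∈ univ.filter (fun y => hammingDist x y = 1), f y

/-- Twice the number of edges `{x,y}` of `H(n,q)` with `f x ≠ f y`
(the number of ordered such pairs). -/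
noncomputable def nuOrd (q n : ℕ) [NeZero q] {α : Type*} (f : (Fin n → ZMod q) → α) : ℕ :=
  (univ.filter (fun p : (Fin n → ZMod q) × (Fin n → ZMod q) =>
    hammingDist p.1 p.2 = 1 ∧ f p.1 ≠ f p.2)).card

/-- Coordinate `i` is relevant for `f`. -/
def Relevant {q n : ℕ} {α : Type*} (f : (Fin n → ZMod q) → α) (i : Fin n) : Prop :=
  ∃ x y : Fin n → ZMod q, (∀ j, j ≠ i → x j = y j) ∧ f x ≠ f y

/-- The function `f_{i,a,b}` on `(ℤ_q)^n` obtained from `f` on `(ℤ_q)^{n+1}`. -/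
noncomputable def restrictDiff {q n : ℕ} (f : (Fin (n + 1) → ZMod q) → ℂ)
    (i : Fin (n + 1)) (a b : ZMod q) : (Fin n → ZMod q) → ℂ :=
  fun y => f (i.insertNth a y) - f (i.insertNth b y)

/-- The size of the support of `g`. -/
noncomputable def suppCard (q n : ℕ) [NeZero q] (g : (Fin n → ZMod q) → ℂ) : ℕ :=
  (univ.filter (fun y => g y ≠ 0)).card

/-- Character via `ZMod.stdAddChar`. -/
noncomputable def XX (q n : ℕ) [NeZero q] (u x : Fin n → ZMod q) : ℂ :=
  ZMod.stdAddChar (∑ i, u i * x i)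

lemma chi_eq_XX (q n : ℕ) [NeZero q] (u x : Fin n → ZMod q) : chi q n u x = XX q n u x := by
  unfold chi XX
  rw [ZMod.stdAddChar_apply, ZMod.toCircle_apply]

lemma XX_symm (q n : ℕ) [NeZero q] (u x : Fin n → ZMod q) : XX q n u x = XX q n x u := by
  unfold XX; simp only [mul_comm]

lemma XX_conj (q n : ℕ) [NeZero q] (u x : Fin n → ZMod q) :
    (starRingEnd ℂ) (XX q n u x) = XX q n (-u) x := by
  unfold XX
  rw [← AddChar.map_neg_eq_conj]
  simp

lemma XX_add (q n : ℕ) [NeZero q] (u v x : Fin n → ZMod q) :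
    XX q n (u + v) x = XX q n u x * XX q n v x := by
  unfold XX
  rw [← AddChar.map_add_eq_mul]
  simp [add_mul, Finset.sum_add_distrib]

lemma sum_std (q : ℕ) [NeZero q] (s : ZMod q) :
    ∑ a : ZMod q, (ZMod.stdAddChar (s * a) : ℂ) = if s = 0 then (q : ℂ) else 0 := by
  have := AddChar.sum_mulShift (R := ZMod q) (R' := ℂ) s (ZMod.isPrimitive_stdAddChar q)
  simp only [mul_comm s, this, ZMod.card]
  split_ifs <;> simp

lemma XX_sum (q n : ℕ) [NeZero q] (u : Fin n → ZMod q) :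
    ∑ x, XX q n u x = if u = 0 then (q : ℂ) ^ n else 0 := by
  have h : ∀ x, XX q n u x = ∏ i, (ZMod.stdAddChar (u i * x i) : ℂ) := by
    intro x; unfold XX; 
    have := map_prod (ZMod.stdAddChar (N := q)).toMonoidHom
      (fun i => Multiplicative.ofAdd (u i * x i)) univ
    simpa [← ofAdd_sum] using this
  simp only [h]
  have := (Finset.prod_univ_sum (fun _ : Fin n => (univ : Finset (ZMod q)))
    (fun i a => (ZMod.stdAddChar (u i * a) : ℂ)))
  rw [Fintype.piFinset_univ] at this
  rw [← this]
  simp only [sum_std]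
  split_ifs with hu
  · subst hu; simp
  · obtain ⟨i, hi⟩ := Function.ne_iff.mp hu
    exact Finset.prod_eq_zero (mem_univ i) (if_neg (by simpa using hi))

lemma XX_orth (q n : ℕ) [NeZero q] (u v : Fin n → ZMod q) :
    ∑ x, XX q n u x * (starRingEnd ℂ) (XX q n v x) = if u = v then (q : ℂ) ^ n else 0 := by
  simp only [XX_conj, ← XX_add, XX_sum, ← sub_eq_add_neg, sub_eq_zero]

lemma inversion (q n : ℕ) [NeZero q] (f : (Fin n → ZMod q) → ℂ) (x : Fin n → ZMod q) :
    f x = ∑ u, fhat q n f u * XX q n u x := by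
  have hq : (q : ℂ) ≠ 0 := by exact_mod_cast NeZero.ne q
  unfold fhat
  simp only [chi_eq_XX, mul_assoc, Finset.sum_mul, ← Finset.mul_sum]
  rw [Finset.sum_comm]
  have : ∀ y, ∑ u, f y * ((starRingEnd ℂ) (XX q n u y) * XX q n u x)
      = f y * if x = y then (q : ℂ) ^ n else 0 := by
    intro y
    rw [← Finset.mul_sum, ← XX_orth]
    congr 1
    refine Finset.sum_congr rfl fun u _ => ?_
    rw [XX_symm q n u x, XX_symm q n u y, mul_comm]
  simp only [this]
  simp
  field_simp

lemma parseval (q n : ℕ) [NeZero q] (c : (Fin n → ZMod q) → ℂ) :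
    ∑ x, ‖∑ u, c u * XX q n u x‖ ^ 2 = (q : ℝ) ^ n * ∑ u, ‖c u‖ ^ 2 := by
  have key : ((∑ x, ‖∑ u, c u * XX q n u x‖ ^ 2 : ℝ) : ℂ)
      = (((q : ℝ) ^ n * ∑ u, ‖c u‖ ^ 2 : ℝ) : ℂ) := by
    push_cast
    simp only [← Complex.mul_conj', map_sum, map_mul, Finset.sum_mul_sum]
    rw [Finset.sum_comm, Finset.mul_sum]
    refine Finset.sum_congr rfl fun u _ => ?_
    rw [Finset.sum_comm]
    have : ∀ v, ∑ x, c u * XX q n u x * ((starRingEnd ℂ) (c v) * (starRingEnd ℂ) (XX q n v x))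
        = c u * (starRingEnd ℂ) (c v) * if u = v then (q : ℂ) ^ n else 0 := by
      intro v
      rw [← XX_orth, Finset.mul_sum]
      refine Finset.sum_congr rfl fun x _ => by ring
    simp only [this]
    simp
    ring
  exact_mod_cast key

/-- degree `< d`. -/
def DegLT (q n : ℕ) [NeZero q] (d : ℕ) (f : (Fin n → ZMod q) → ℂ) : Prop :=
  ∃ c : (Fin n → ZMod q) → ℂ, (∀ u, d ≤ hammingNorm u → c u = 0) ∧
    ∀ x, f x = ∑ u, c u * XX q n u x

lemma DegLT.zero {q n : ℕ} [NeZero q] {f : (Fin n → ZMod q) → ℂ} (h : DegLT q n 0 f) : f = 0 := by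
  obtain ⟨c, hc, hf⟩ := h
  funext x
  rw [hf]
  simp [hc _ (Nat.zero_le _)]

lemma hammingNorm_insertNth {q n : ℕ} (i : Fin (n + 1)) (s : ZMod q)
    (v : Fin n → ZMod q) :
    hammingNorm (i.insertNth (α := fun _ => ZMod q) s v : Fin (n + 1) → ZMod q)
      = (if s = 0 then 0 else 1) + hammingNorm v := by
  unfold hammingNorm
  rw [Finset.card_filter, Finset.card_filter, Fin.sum_univ_succAbove _ i]
  simp

lemma XX_insertNth {q n : ℕ} [NeZero q] (i : Fin (n + 1)) (s a : ZMod q)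
    (v y : Fin n → ZMod q) :
    XX q (n + 1) (i.insertNth (α := fun _ => ZMod q) s v) (i.insertNth (α := fun _ => ZMod q) a y)
      = ZMod.stdAddChar (s * a) * XX q n v y := by
  unfold XX
  rw [Fin.sum_univ_succAbove _ i]
  simp [AddChar.map_add_eq_mul]

lemma sum_insertNth {q n : ℕ} [NeZero q] {M : Type*} [AddCommMonoid M] (i : Fin (n + 1))
    (F : (Fin (n + 1) → ZMod q) → M) :
    ∑ x, F x = ∑ a : ZMod q, ∑ y : Fin n → ZMod q, F (i.insertNth (α := fun _ => ZMod q) a y) := by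
  rw [← Fintype.sum_prod_type']
  exact (Equiv.sum_comp (Fin.insertNthEquiv (fun _ => ZMod q) i) F).symm

lemma DegLT.restrict {q n d : ℕ} [NeZero q] {f : (Fin (n + 1) → ZMod q) → ℂ}
    (h : DegLT q (n + 1) d f) (i : Fin (n + 1)) (a : ZMod q) :
    DegLT q n d (fun y => f (i.insertNth (α := fun _ => ZMod q) a y)) := by
  obtain ⟨c, hc, hf⟩ := h
  refine ⟨fun v => ∑ s, c (i.insertNth (α := fun _ => ZMod q) s v) * ZMod.stdAddChar (s * a),
    ?_, ?_⟩
  · intro v hv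
    refine Finset.sum_eq_zero fun s _ => ?_
    rw [hc, zero_mul]
    rw [hammingNorm_insertNth]; omega
  · intro y
    show f _ = _
    rw [hf, sum_insertNth i, Finset.sum_comm]
    simp only [XX_insertNth, Finset.sum_mul, mul_assoc]

lemma DegLT.diff {q n d : ℕ} [NeZero q] {f : (Fin (n + 1) → ZMod q) → ℂ}
    (h : DegLT q (n + 1) (d + 1) f) (i : Fin (n + 1)) (a b : ZMod q) :
    DegLT q n d (restrictDiff f i a b) := by
  obtain ⟨c, hc, hf⟩ := h
  refine ⟨fun v => ∑ s, c (i.insertNth (α := fun _ => ZMod q) s v) *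
    (ZMod.stdAddChar (s * a) - ZMod.stdAddChar (s * b)), ?_, ?_⟩
  · intro v hv
    refine Finset.sum_eq_zero fun s _ => ?_
    by_cases hs : s = 0
    · simp [hs]
    · rw [hc, zero_mul]
      rw [hammingNorm_insertNth, if_neg hs]; omega
  · intro y
    unfold restrictDiff
    rw [hf, hf, sum_insertNth i, sum_insertNth i, ← Finset.sum_sub_distrib]
    simp only [← Finset.sum_sub_distrib]
    rw [Finset.sum_comm]
    simp only [XX_insertNth, Finset.sum_mul]
    refine Finset.sum_congr rfl fun v _ => Finset.sum_congr rfl fun s _ => ?_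
    ring

lemma suppCard_eq {q n : ℕ} [NeZero q] (g : (Fin (n + 1) → ZMod q) → ℂ) (i : Fin (n + 1)) :
    suppCard q (n + 1) g =
      ∑ a, suppCard q n (fun y => g (i.insertNth (α := fun _ => ZMod q) a y)) := by
  unfold suppCard
  simp only [Finset.card_filter]
  rw [sum_insertNth i]

lemma supp_bound {q : ℕ} [NeZero q] : ∀ (n d : ℕ) (g : (Fin n → ZMod q) → ℂ),
    DegLT q n d g → g ≠ 0 → q ^ (n + 1) ≤ q ^ d * suppCard q n g := by
  have hq : 1 ≤ q := Nat.one_le_iff_ne_zero.mpr (NeZero.ne q)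
  intro n
  induction n with
  | zero =>
    intro d g hg h0
    rcases d with _ | d
    · exact absurd hg.zero h0
    have : 1 ≤ suppCard q 0 g := by
      obtain ⟨x, hx⟩ := Function.ne_iff.mp h0
      exact Finset.card_pos.mpr ⟨x, mem_filter.mpr ⟨mem_univ _, hx⟩⟩
    calc q ^ (0 + 1) ≤ q ^ (d + 1) := Nat.pow_le_pow_right hq (by omega)
      _ ≤ _ := Nat.le_mul_of_pos_right _ this
  | succ n ih =>
    intro d g hg h0
    rw [suppCard_eq g 0]
    by_cases hall : ∀ a : ZMod q,
        (fun y : Fin n → ZMod q => g ((0 : Fin (n+1)).insertNth (α := fun _ => ZMod q) a y)) ≠ 0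
    · rw [Finset.mul_sum]
      calc q ^ (n + 1 + 1) = ∑ a : ZMod q, q ^ (n + 1) := by simp [ZMod.card, pow_succ']
        _ ≤ _ := Finset.sum_le_sum fun a _ => ih d _ (hg.restrict 0 a) (hall a)
    · push Not at hall
      obtain ⟨a, ha⟩ := hall
      obtain ⟨x, hx⟩ := Function.ne_iff.mp h0
      rcases d with _ | d
      · exact absurd hg.zero h0
      have e : restrictDiff g 0 (x 0) a =
          fun y => g ((0 : Fin (n+1)).insertNth (α := fun _ => ZMod q) (x 0) y) := by
        funext y
        have := congrFun ha y
        simp only [Pi.zero_apply] at this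
        simp [restrictDiff] at this ⊢
        exact this
      have h1 := ih d _ (hg.diff 0 (x 0) a) (by
        rw [e]
        intro h
        apply hx
        have := congrFun h (Fin.tail x)
        simpa using this)
      rw [e] at h1
      have h2 := Finset.single_le_sum (f := fun a => suppCard q n
        (fun y => g ((0 : Fin (n+1)).insertNth (α := fun _ => ZMod q) a y)))
        (fun _ _ => Nat.zero_le _) (mem_univ (x 0))
      calc q ^ (n + 1 + 1) = q * q ^ (n + 1) := pow_succ' _ _
        _ ≤ q * (q ^ d * _) := Nat.mul_le_mul_left _ h1
        _ = q ^ (d + 1) * _ := by rw [pow_succ', mul_assoc]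
        _ ≤ _ := Nat.mul_le_mul_left _ h2

/-- number of (x,a) with f x ≠ f (x + a e_i). -/
noncomputable def NN {q n : ℕ} [NeZero q] (f : (Fin n → ZMod q) → ℂ) (i : Fin n) : ℕ :=
  ∑ a : ZMod q, ∑ x : Fin n → ZMod q, if f x ≠ f (x + Pi.single i a) then 1 else 0

lemma NN_eq {q n : ℕ} [NeZero q] (f : (Fin (n + 1) → ZMod q) → ℂ) (i : Fin (n + 1)) :
    NN f i = ∑ b : ZMod q, ∑ a : ZMod q, suppCard q n (restrictDiff f i b a) := by
  unfold NN
  simp only [sum_insertNth i, suppCard, Finset.card_filter]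
  rw [Finset.sum_comm]
  refine Finset.sum_congr rfl fun b _ => ?_
  rw [← Equiv.sum_comp (Equiv.addLeft b) (fun a => ∑ y : Fin n → ZMod q,
    if restrictDiff f i b a y ≠ 0 then 1 else 0)]
  refine Finset.sum_congr rfl fun a _ => Finset.sum_congr rfl fun y _ => ?_
  have : (i.insertNth (α := fun _ => ZMod q) b y : Fin (n+1) → ZMod q) + Pi.single i a
      = i.insertNth (α := fun _ => ZMod q) (b + a) y := by
    funext j
    refine Fin.succAboveCases i ?_ ?_ j
    · simp
    · intro k; simp
  rw [this]
  simp [restrictDiff, sub_eq_zero]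

lemma pairs_card {q : ℕ} [NeZero q] {β : Type*} (F : ZMod q → β) (a b : ZMod q) (h : F a ≠ F b) :
    2 * (q - 1) ≤ ((univ : Finset (ZMod q × ZMod q)).filter (fun p => F p.1 ≠ F p.2)).card := by
  set A : Finset (ZMod q) := univ.filter (fun c => F c = F a) with hA
  have hd : Disjoint (A ×ˢ Aᶜ) (Aᶜ ×ˢ A) := by
    rw [Finset.disjoint_left]
    rintro ⟨x, y⟩ h1 h2
    simp only [mem_product, mem_compl] at h1 h2
    exact h2.1 h1.1
  have hs : (A ×ˢ Aᶜ) ∪ (Aᶜ ×ˢ A) ⊆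
      (univ : Finset (ZMod q × ZMod q)).filter (fun p => F p.1 ≠ F p.2) := by
    rintro ⟨x, y⟩ hxy
    simp only [mem_union, mem_product, mem_compl, hA, mem_filter, mem_univ, true_and] at hxy ⊢
    rcases hxy with ⟨h1, h2⟩ | ⟨h1, h2⟩
    · rw [h1]; exact fun e => h2 e.symm
    · rw [h2]; exact h1
  have hc := Finset.card_le_card hs
  rw [Finset.card_union_of_disjoint hd, card_product, card_product] at hc
  have h1 : 0 < A.card := Finset.card_pos.mpr ⟨a, by simp [hA]⟩
  have h2 : 0 < Aᶜ.card := Finset.card_pos.mpr ⟨b, by simpa [hA] using fun e => h e.symm⟩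
  have h3 : A.card + Aᶜ.card = q := by rw [Finset.card_add_card_compl, ZMod.card]
  refine le_trans ?_ hc
  obtain ⟨k, hk⟩ := Nat.exists_eq_add_of_le' h1
  obtain ⟨l, hl⟩ := Nat.exists_eq_add_of_le' h2
  rw [hk, hl] at h3 ⊢
  have : q - 1 = k + l + 1 := by omega
  rw [this]
  nlinarith [Nat.zero_le (k * l)]

lemma lower {q n d : ℕ} [NeZero q] (f : (Fin n → ZMod q) → ℂ) (hf : DegLT q n (d + 1) f)
    (i : Fin n) (hi : Relevant f i) : 2 * (q - 1) * q ^ n ≤ q ^ d * NN f i := by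
  rcases n with _ | n
  · exact i.elim0
  obtain ⟨x, y, hxy, hne⟩ := hi
  set F : ZMod q → ((Fin n → ZMod q) → ℂ) :=
    fun a y => f (i.insertNth (α := fun _ => ZMod q) a y) with hF
  have hab : F (x i) ≠ F (y i) := by
    intro h
    have h1 := congrFun h (i.removeNth x)
    have h2 : i.removeNth x = i.removeNth y := by
      funext j; exact hxy _ (Fin.succAbove_ne i j)
    apply hne
    simp only [hF] at h1
    rw [Fin.insertNth_self_removeNth, h2, Fin.insertNth_self_removeNth] at h1
    exact h1
  have hp := pairs_card F _ _ hab
  rw [NN_eq, ← Fintype.sum_prod_type' (f := fun b a => suppCard q n (restrictDiff f i b a)),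
    Finset.mul_sum]
  calc 2 * (q - 1) * q ^ (n + 1)
      ≤ ((univ : Finset (ZMod q × ZMod q)).filter (fun p => F p.1 ≠ F p.2)).card * q ^ (n + 1) :=
        Nat.mul_le_mul_right _ (by convert hp)
    _ = ∑ p ∈ (univ : Finset (ZMod q × ZMod q)).filter (fun p => F p.1 ≠ F p.2), q ^ (n + 1) := by
        simp
    _ ≤ ∑ p ∈ (univ : Finset (ZMod q × ZMod q)).filter (fun p => F p.1 ≠ F p.2),
          q ^ d * suppCard q n (restrictDiff f i p.1 p.2) := by
        refine Finset.sum_le_sum fun p hp => ?_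
        refine supp_bound n d _ (hf.diff i p.1 p.2) ?_
        intro h
        refine (mem_filter.mp hp).2 ?_
        funext z
        exact sub_eq_zero.mp (congrFun h z)
    _ ≤ _ := Finset.sum_le_sum_of_subset (Finset.filter_subset _ _)

lemma sum_norm (q : ℕ) [NeZero q] (s : ZMod q) :
    ∑ a : ZMod q, ‖(1 : ℂ) - ZMod.stdAddChar (s * a)‖ ^ 2 = if s = 0 then (0 : ℝ) else 2 * q := by
  have key : ((∑ a : ZMod q, ‖(1 : ℂ) - ZMod.stdAddChar (s * a)‖ ^ 2 : ℝ) : ℂ)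
      = ((if s = 0 then (0 : ℝ) else 2 * q : ℝ) : ℂ) := by
    push_cast
    have : ∀ a : ZMod q, ((‖(1 : ℂ) - ZMod.stdAddChar (s * a)‖ : ℝ) : ℂ) ^ 2 =
        2 - ZMod.stdAddChar (s * a) - ZMod.stdAddChar (-s * a) := by
      intro a
      rw [← Complex.mul_conj', map_sub, map_one, ← AddChar.map_neg_eq_conj, neg_mul]
      have h : (ZMod.stdAddChar (s * a) : ℂ) * ZMod.stdAddChar (-(s * a)) = 1 := by
        rw [← AddChar.map_add_eq_mul]; simp
      linear_combination h
    simp only [this, Finset.sum_sub_distrib, sum_std]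
    by_cases hs : s = 0
    · simp [hs, ZMod.card]; ring
    · simp [hs, ZMod.card]; ring
  exact_mod_cast key

lemma upper {q n d : ℕ} [NeZero q] (f : (Fin n → ZMod q) → ℂ) (hbool : ∀ x, f x = 1 ∨ f x = -1)
    (hf : DegLT q n (d + 1) f) :
    4 * ∑ i, (NN f i : ℝ) ≤ 2 * q * d * q ^ n := by
  obtain ⟨c, hc, hfc⟩ := hf
  have h1 : ∀ i, 4 * (NN f i : ℝ) = ∑ a : ZMod q, ∑ x, ‖f x - f (x + Pi.single i a)‖ ^ 2 := by
    intro i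
    unfold NN
    push_cast
    simp only [Finset.mul_sum]
    refine Finset.sum_congr rfl fun a _ => Finset.sum_congr rfl fun x _ => ?_
    rcases hbool x with h | h <;> rcases hbool (x + Pi.single i a) with h' | h' <;>
      rw [h, h'] <;> norm_num
  have h2 : ∀ (i : Fin n) (a : ZMod q), ∑ x, ‖f x - f (x + Pi.single i a)‖ ^ 2
      = (q : ℝ) ^ n * ∑ u : Fin n → ZMod q,
        ‖c u‖ ^ 2 * ‖(1 : ℂ) - ZMod.stdAddChar (u i * a)‖ ^ 2 := by
    intro i a
    simp only [← mul_pow, ← norm_mul]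
    rw [← parseval]
    refine Finset.sum_congr rfl fun x _ => ?_
    congr 2
    rw [hfc, hfc, ← Finset.sum_sub_distrib]
    refine Finset.sum_congr rfl fun u _ => ?_
    have : XX q n u (x + Pi.single i a) = XX q n u x * ZMod.stdAddChar (u i * a) := by
      rw [XX_symm, XX_add, XX_symm q n x]
      congr 1
      unfold XX
      congr 1
      rw [Finset.sum_eq_single i]
      · simp [mul_comm]
      · intro j _ hj; simp [hj]
      · simp
    rw [this]; ring
  have h3 : (q : ℝ) ^ n * ∑ u, ‖c u‖ ^ 2 = (q : ℝ) ^ n := by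
    rw [← parseval]
    have : ∀ x, ‖∑ u, c u * XX q n u x‖ ^ 2 = 1 := by
      intro x
      rw [← hfc]
      rcases hbool x with h | h <;> simp [h]
    simp [this, ZMod.card]
  have h4 : ∀ u : Fin n → ZMod q, ∑ i, (if u i = 0 then (0 : ℝ) else 2 * q)
      = 2 * q * hammingNorm u := by
    intro u
    unfold hammingNorm
    rw [Finset.card_filter]
    push_cast
    rw [Finset.mul_sum]
    refine Finset.sum_congr rfl fun i _ => ?_
    by_cases h : u i = 0 <;> simp [h]
  calc 4 * ∑ i, (NN f i : ℝ)
      = ∑ i, ∑ a : ZMod q, (q : ℝ) ^ n * ∑ u : Fin n → ZMod q,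
        ‖c u‖ ^ 2 * ‖(1 : ℂ) - ZMod.stdAddChar (u i * a)‖ ^ 2 := by
        rw [Finset.mul_sum]; simp only [h1, h2]
    _ = (q : ℝ) ^ n * ∑ u : Fin n → ZMod q, ‖c u‖ ^ 2 * (2 * q * hammingNorm u) := by
        simp only [← h4, ← sum_norm, ← Finset.mul_sum]
        congr 1
        rw [Finset.sum_congr rfl fun i _ => Finset.sum_comm, Finset.sum_comm]
        simp only [← Finset.mul_sum]
    _ ≤ (q : ℝ) ^ n * ∑ u : Fin n → ZMod q, ‖c u‖ ^ 2 * (2 * q * d) := by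
        refine mul_le_mul_of_nonneg_left (Finset.sum_le_sum fun u _ => ?_) (by positivity)
        by_cases hu : d + 1 ≤ hammingNorm u
        · simp [hc u hu]
        · gcongr; omega
    _ = 2 * q * d * ((q : ℝ) ^ n * ∑ u : Fin n → ZMod q, ‖c u‖ ^ 2) := by
        rw [← Finset.sum_mul]; ring
    _ = _ := by rw [h3]

theorem stmt11 (q n d : ℕ) [NeZero q] (hq : 3 ≤ q)
    (f : (Fin n → ZMod q) → ℂ) (hbool : ∀ x, f x = 1 ∨ f x = -1)
    (hdeg : ∀ u : Fin n → ZMod q, d < hammingNorm u → fhat q n f u = 0) :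
    ((univ.filter (fun i : Fin n => Relevant f i)).card : ℝ)
      ≤ (d : ℝ) * (q : ℝ) ^ (d + 1) / (4 * ((q : ℝ) - 1)) := by
  have hf : DegLT q n (d + 1) f :=
    ⟨fhat q n f, fun u hu => hdeg u hu, inversion q n f⟩
  have hu := upper f hbool hf
  have hq' : (3 : ℝ) ≤ q := by exact_mod_cast hq
  have hl : ∀ i, Relevant f i → 2 * ((q : ℝ) - 1) * q ^ n ≤ q ^ d * NN f i := by
    intro i hi
    have := lower f hf i hi
    have h2 : ((2 * (q - 1) * q ^ n : ℕ) : ℝ) ≤ ((q ^ d * NN f i : ℕ) : ℝ) := by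
      exact_mod_cast this
    push_cast [Nat.cast_sub (show 1 ≤ q by omega)] at h2
    exact h2
  have hs : ((univ.filter (fun i : Fin n => Relevant f i)).card : ℝ) *
      (2 * ((q : ℝ) - 1) * q ^ n) ≤ q ^ d * ∑ i, (NN f i : ℝ) := by
    rw [← nsmul_eq_mul, ← Finset.sum_const, Finset.mul_sum]
    refine (Finset.sum_le_sum fun i hi => hl i (mem_filter.mp hi).2).trans ?_
    exact Finset.sum_le_sum_of_subset_of_nonneg (Finset.filter_subset _ _)
      fun _ _ _ => by positivity
  set R : ℝ := ((univ.filter (fun i : Fin n => Relevant f i)).card : ℝ)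
  rw [le_div_iff₀ (by linarith)]
  have hqn : (0 : ℝ) < q ^ n := by positivity
  have hqd : (0 : ℝ) ≤ q ^ d := by positivity
  have h5 := mul_le_mul_of_nonneg_left hu hqd
  refine le_of_mul_le_mul_right ?_ hqn
  rw [pow_succ]
  nlinarith
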